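/- arXiv:2001.08722 — 2 statements merged into one kernel-verified Lean document; each statement's English description precedes it below -/
import Mathlib

section
/- Let M be a monoid such that for every element m of M the set of pairs (a,b) with a*b = m is finite. Then every element of M that has a left inverse is invertible: if b*a = 1 then also a*b = 1. -/
/-- A monoid in which every element has only finitely many two-factor
decompositions (a "decomposition finite" monoid) has the property that
every left-invertible element is invertible. -/
theorem stmt_0 {M : Type*} [Monoid M]
    (h : ∀ m : M, {p : M × M | p.1 * p.2 = m}.Finite) :
    ∀ a b : M, b * a = 1 → a * b = 1 := by
  intro a b hba
  have hp : ∀ n : ℕ, b ^ n * a ^ n = 1 := fun n => pow_mul_pow_eq_one n hba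
  obtain ⟨i, j, hij, he⟩ : ∃ i j : ℕ, i < j ∧ a ^ i = a ^ j := by
    obtain ⟨i, j, hij, he⟩ := (h 1).exists_lt_map_eq_of_forall_mem
      (f := fun n : ℕ => (b ^ n, a ^ n)) (fun n => hp n)
    exact ⟨i, j, hij, congrArg Prod.snd he⟩
  obtain ⟨k, rfl⟩ : ∃ k, j = i + (k + 1) := ⟨j - i - 1, by omega⟩
  have h1 : a ^ (k + 1) = 1 := by
    calc a ^ (k + 1) = (b ^ i * a ^ i) * a ^ (k + 1) := by rw [hp, one_mul]
      _ = b ^ i * a ^ (i + (k + 1)) := by rw [mul_assoc, ← pow_add]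
      _ = 1 := by rw [← he, hp]
  have h2 : a * a ^ k = 1 := by rw [← pow_succ', h1]
  have h3 : b = a ^ k := left_inv_eq_right_inv hba h2
  rw [h3, h2]
end

section
/- Let B be the free ℤ-module whose basis is the set of all monotone surjections f : Fin n → Fin m, for all n, m ≥ 0 (including the empty map Fin 0 → Fin 0). Equip B with the product given on basis elements by juxtaposition (ordinal sum) f · g := f ⊞ g with unit the empty map, and with the coproduct Δ(f) = Σ f₀ ⊗ f₁, the sum over all factorizations f = f₀ ∘ f₁ of f into two monotone surjections, and counit ε(f) = 1 if f is an identity map and 0 otherwise. Then (B, ·, unit, Δ, ε) is a bialgebra over ℤ; in particular Δ(f ⊞ g) = Δ(f) · Δ(g) where the product on B ⊗ B is componentwise. -/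
open TensorProduct

/-- The juxtaposition (ordinal sum) of `f : Fin n → Fin p` and
`g : Fin n' → Fin p'`. -/
def ordSum {n p n' p' : ℕ} (f : Fin n → Fin p) (g : Fin n' → Fin p') :
    Fin (n + n') → Fin (p + p') := fun i =>
  if h : (i : ℕ) < n then Fin.castAdd p' (f ⟨i, h⟩)
  else Fin.natAdd p (g ⟨(i : ℕ) - n, by have := i.isLt; omega⟩)

/-- Monotone surjections `Fin n → Fin m`. -/
abbrev MonoSurj (n m : ℕ) : Type :=
  {f : Fin n → Fin m // Monotone f ∧ Function.Surjective f}

/-- The basis of the bialgebra: all monotone surjections between the standard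
finite ordered sets. -/
abbrev MSArr : Type := Σ n : ℕ, Σ m : ℕ, MonoSurj n m

/-- The identity `Fin n → Fin n` as a basis element. -/
def idMS (n : ℕ) : MSArr := ⟨n, n, ⟨id, monotone_id, Function.surjective_id⟩⟩

/-- The type of factorizations of a monotone surjection `a` into two monotone
surjections. -/
def FactMS (a : MSArr) : Type :=
  {p : Σ k : ℕ, MonoSurj k a.2.1 × MonoSurj a.1 k // p.2.1.1 ∘ p.2.2.1 = a.2.2.1}


namespace MSAux

/-- Extension of a monotone surjection to the natural numbers by a shift. -/
def phi (a : MSArr) (i : ℕ) : ℕ :=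
  if h : i < a.1 then (a.2.2.1 ⟨i, h⟩ : ℕ) else a.2.1 + (i - a.1)

lemma phi_lt (a : MSArr) {i : ℕ} (h : i < a.1) : phi a i = (a.2.2.1 ⟨i, h⟩ : ℕ) := by
  simp [phi, h]

lemma phi_ge (a : MSArr) {i : ℕ} (h : a.1 ≤ i) : phi a i = a.2.1 + (i - a.1) := by
  simp [phi, Nat.not_lt.2 h]

lemma phi_lt_m (a : MSArr) {i : ℕ} (h : i < a.1) : phi a i < a.2.1 := by
  rw [phi_lt a h]; exact Fin.isLt _

lemma phi_n (a : MSArr) : phi a a.1 = a.2.1 := by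
  simp [phi]

lemma phi_mono (a : MSArr) : Monotone (phi a) := by
  intro i j hij
  rcases lt_or_ge j a.1 with hj | hj
  · rw [phi_lt a hj, phi_lt a (lt_of_le_of_lt hij hj)]
    exact a.2.2.2.1 (by simpa using hij)
  · rcases lt_or_ge i a.1 with hi | hi
    · have := phi_lt_m a hi
      rw [phi_ge a hj]; omega
    · rw [phi_ge a hj, phi_ge a hi]; omega

lemma phi_surj (a : MSArr) : Function.Surjective (phi a) := by
  intro j
  rcases lt_or_ge j a.2.1 with hj | hj
  · obtain ⟨i, hi⟩ := a.2.2.2.2 ⟨j, hj⟩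
    refine ⟨i, ?_⟩
    rw [phi_lt a i.2]; simp [hi]
  · refine ⟨a.1 + (j - a.2.1), ?_⟩
    rw [phi_ge a (by omega)]; omega

lemma phi_zero (a : MSArr) : phi a 0 = 0 := by
  obtain ⟨i, hi⟩ := phi_surj a 0
  have := phi_mono a (Nat.zero_le i)
  omega

lemma ext' {a b : MSArr} (hn : a.1 = b.1) (h : ∀ i, phi a i = phi b i) : a = b := by
  have hm : a.2.1 = b.2.1 := by rw [← phi_n a, ← phi_n b, hn, h]
  have hf : ∀ i (h₁ : i < a.1) (h₂ : i < b.1),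
      (a.2.2.1 ⟨i, h₁⟩ : ℕ) = (b.2.2.1 ⟨i, h₂⟩ : ℕ) := by
    intro i h₁ h₂
    rw [← phi_lt a h₁, ← phi_lt b h₂, h]
  clear h
  obtain ⟨n, m, f, hf1⟩ := a
  obtain ⟨n', m', g, hg1⟩ := b
  simp only at hn hm
  subst hn
  subst hm
  have : f = g := by
    funext i
    exact Fin.ext (hf i.1 i.2 i.2)
  subst this
  rfl

lemma exists_of (n : ℕ) (φ : ℕ → ℕ) (hm : Monotone φ) (hs : Function.Surjective φ)
    (hsh : ∀ k, n ≤ k → φ k = φ n + (k - n)) (hcut : ∀ j < n, φ j < φ n) :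
    ∃ a : MSArr, a.1 = n ∧ ∀ i, phi a i = φ i := by
  refine ⟨⟨n, φ n, fun i => ⟨φ i, hcut i i.2⟩, ?_, ?_⟩, rfl, ?_⟩
  · intro i j hij
    exact hm hij
  · rintro ⟨j, hj⟩
    obtain ⟨i, rfl⟩ := hs j
    exact ⟨⟨i, hm.reflect_lt hj⟩, rfl⟩
  · intro i
    rcases lt_or_ge i n with h | h
    · rw [phi_lt _ h]
    · rw [phi_ge _ h, hsh i h]

lemma ordSum_val {n p n' p' : ℕ} (f : Fin n → Fin p) (g : Fin n' → Fin p')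
    (i : Fin (n + n')) : (ordSum f g i : ℕ) =
      if h : (i : ℕ) < n then (f ⟨i, h⟩ : ℕ) else
        p + (g ⟨(i : ℕ) - n, by have := i.isLt; omega⟩ : ℕ) := by
  unfold ordSum
  split_ifs <;> simp

lemma ordSum_phi (a b : MSArr) (i : Fin (a.1 + b.1)) :
    (ordSum a.2.2.1 b.2.2.1 i : ℕ) =
      if (i : ℕ) < a.1 then phi a i else a.2.1 + phi b (i - a.1) := by
  rw [ordSum_val]
  split_ifs with h
  · rw [phi_lt a h]
  · rw [phi_lt b]

lemma ordSum_mono (a b : MSArr) : Monotone (ordSum a.2.2.1 b.2.2.1) := by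
  intro i j hij
  have hij' : (i : ℕ) ≤ j := hij
  rw [Fin.le_def, ordSum_phi, ordSum_phi]
  split_ifs with h1 h2 h2
  · exact phi_mono a hij
  · have := phi_lt_m a h1; omega
  · omega
  · have := phi_mono b (show (i : ℕ) - a.1 ≤ j - a.1 by omega)
    omega

lemma ordSum_surj (a b : MSArr) : Function.Surjective (ordSum a.2.2.1 b.2.2.1) := by
  rintro ⟨j, hj⟩
  rcases lt_or_ge j a.2.1 with h | h
  · obtain ⟨i, hi⟩ := a.2.2.2.2 ⟨j, h⟩
    refine ⟨Fin.castAdd _ i, Fin.ext ?_⟩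
    rw [ordSum_phi]
    simp [phi_lt a i.2, hi]
  · obtain ⟨i, hi⟩ := b.2.2.2.2 ⟨j - a.2.1, by omega⟩
    refine ⟨Fin.natAdd _ i, Fin.ext ?_⟩
    rw [ordSum_phi]
    simp [phi_lt b i.2, hi]
    omega

/-- Juxtaposition of basis elements. -/
def jux (a b : MSArr) : MSArr :=
  ⟨a.1 + b.1, a.2.1 + b.2.1, ⟨ordSum a.2.2.1 b.2.2.1, ordSum_mono a b, ordSum_surj a b⟩⟩

@[simp] lemma jux_n (a b : MSArr) : (jux a b).1 = a.1 + b.1 := rfl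
@[simp] lemma jux_m (a b : MSArr) : (jux a b).2.1 = a.2.1 + b.2.1 := rfl

lemma phi_jux (a b : MSArr) (i : ℕ) :
    phi (jux a b) i = if i < a.1 then phi a i else a.2.1 + phi b (i - a.1) := by
  rcases lt_or_ge i (a.1 + b.1) with h | h
  · rw [phi_lt (jux a b) h]
    exact ordSum_phi a b ⟨i, h⟩
  · rw [phi_ge (jux a b) h, if_neg (by omega), phi_ge b (by omega)]
    simp only [jux_n, jux_m]
    omega

@[simp] lemma id_n (n : ℕ) : (idMS n).1 = n := rfl
@[simp] lemma id_m (n : ℕ) : (idMS n).2.1 = n := rfl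

@[simp] lemma phi_id (n i : ℕ) : phi (idMS n) i = i := by
  rcases lt_or_ge i n with h | h
  · rw [phi_lt (idMS n) h]; rfl
  · rw [phi_ge (idMS n) h]; simp; omega

lemma jux_assoc (a b c : MSArr) : jux (jux a b) c = jux a (jux b c) := by
  apply ext'
  · simp [add_assoc]
  · intro i
    simp only [phi_jux, jux_n, jux_m]
    have : i - a.1 - b.1 = i - (a.1 + b.1) := by omega
    rw [this]
    split_ifs <;> omega

lemma id_jux (a : MSArr) : jux (idMS 0) a = a := by
  apply ext'
  · simp
  · intro i
    simp [phi_jux]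

lemma jux_id (a : MSArr) : jux a (idMS 0) = a := by
  apply ext'
  · simp
  · intro i
    simp only [phi_jux, phi_id]
    split_ifs with h
    · rfl
    · rw [phi_ge a (by omega)]

lemma id_jux_id (m n : ℕ) : jux (idMS m) (idMS n) = idMS (m + n) := by
  apply ext'
  · simp
  · intro i
    simp only [phi_jux, phi_id, id_n, id_m]
    split_ifs <;> omega

lemma jux_inj {a b c d : MSArr} (h : jux a b = jux c d) (hn : a.1 = c.1) :
    a = c ∧ b = d := by
  have hn2 : a.1 + b.1 = c.1 + d.1 := congrArg Sigma.fst h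
  have hp : ∀ i, phi (jux a b) i = phi (jux c d) i := fun i => by rw [h]
  have hm : a.2.1 = c.2.1 := by
    have := hp a.1
    rw [phi_jux, phi_jux, if_neg (by omega), if_neg (by omega)] at this
    simpa [hn, phi_zero] using this
  constructor
  · refine ext' hn fun i => ?_
    rcases lt_or_ge i a.1 with hi | hi
    · have := hp i
      rwa [phi_jux, phi_jux, if_pos hi, if_pos (by omega)] at this
    · rw [phi_ge a hi, phi_ge c (by omega), hm, hn]
  · refine ext' (by omega) fun i => ?_
    have := hp (a.1 + i)
    rw [phi_jux, phi_jux, if_neg (by omega), if_neg (by omega)] at this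
    simpa [hn, hm] using this

lemma exists_split (Y : MSArr) (n : ℕ) (hn : n ≤ Y.1) (hc : ∀ j < n, phi Y j < phi Y n) :
    ∃ y y' : MSArr, y.1 = n ∧ Y = jux y y' := by
  have hmono := phi_mono Y
  obtain ⟨y, hy, hy2⟩ := exists_of n (fun j => if j < n then phi Y j else phi Y n + (j - n))
    (by
      intro i j hij
      dsimp only
      split_ifs with h1 h2
      · exact hmono hij
      · have := hc i h1; omega
      · omega
      · omega)
    (by
      intro j
      rcases lt_or_ge j (phi Y n) with h | h
      · obtain ⟨i, rfl⟩ := phi_surj Y j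
        exact ⟨i, by simp [hmono.reflect_lt h]⟩
      · refine ⟨n + (j - phi Y n), ?_⟩
        simp; omega)
    (by intro k hk; simp [Nat.not_lt.2 hk])
    (by intro j hj; simp [hj, hc j hj])
  obtain ⟨y', hy', hy2'⟩ := exists_of (Y.1 - n) (fun j => phi Y (n + j) - phi Y n)
    (by
      intro i j hij
      have := hmono (show n + i ≤ n + j by omega)
      dsimp only; omega)
    (by
      intro j
      obtain ⟨i, hi⟩ := phi_surj Y (phi Y n + j)
      rcases lt_or_ge i n with h | h
      · have := hc i h; omega
      · refine ⟨i - n, ?_⟩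
        simp only [Nat.add_sub_cancel' h]
        omega)
    (by
      intro k hk
      have h1 := hmono hn
      have h2 := phi_n Y
      simp only [Nat.add_sub_cancel' hn]
      rw [phi_ge Y (show Y.1 ≤ n + k by omega)]
      omega)
    (by
      intro j hj
      have h1 := hmono (show n ≤ n + j by omega)
      have h2 := phi_n Y
      have h3 := phi_lt_m Y (show n + j < Y.1 by omega)
      simp only [Nat.add_sub_cancel' hn]
      omega)
  refine ⟨y, y', hy, ext' (by simp; omega) fun i => ?_⟩
  have hym : y.2.1 = phi Y n := by rw [← phi_n y, hy2, hy]; simp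
  rw [phi_jux, hy2, hy2', hym, hy]
  split_ifs with h
  · rfl
  · have := hmono (show n ≤ i by omega)
    rw [Nat.add_sub_cancel' (show n ≤ i by omega)]
    omega

/-- Composition of composable basis elements (junk otherwise). -/
def comp (x y : MSArr) : MSArr :=
  if h : y.2.1 = x.1 then
    ⟨y.1, x.2.1, ⟨fun i => x.2.2.1 (Fin.cast h (y.2.2.1 i)),
      fun _ _ hij => x.2.2.2.1 (y.2.2.2.1 hij),
      fun j => by
        obtain ⟨k, hk⟩ := x.2.2.2.2 j
        obtain ⟨i, hi⟩ := y.2.2.2.2 (Fin.cast h.symm k)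
        exact ⟨i, by simp only [hi, ← hk]; rfl⟩⟩⟩
  else y

@[simp] lemma comp_n (x y : MSArr) : (comp x y).1 = y.1 := by
  unfold comp
  split_ifs <;> rfl

lemma comp_m {x y : MSArr} (h : y.2.1 = x.1) : (comp x y).2.1 = x.2.1 := by
  unfold comp
  rw [dif_pos h]

lemma phi_comp {x y : MSArr} (h : y.2.1 = x.1) (i : ℕ) :
    phi (comp x y) i = phi x (phi y i) := by
  rcases lt_or_ge i y.1 with hi | hi
  · have h1 : phi y i < x.1 := h ▸ phi_lt_m y hi
    rw [phi_lt x h1]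
    have hc : comp x y = _ := dif_pos h
    rw [hc]
    refine (phi_lt _ ?_).trans ?_
    · exact hi
    congr 2
    apply Fin.ext
    simp [phi_lt y hi]
    rfl
  · rw [phi_ge (comp x y) (by simpa using hi), comp_m h, phi_ge y hi, phi_ge x (by omega)]
    simp [h]

lemma comp_assoc {x y z : MSArr} (h : y.2.1 = x.1) (h' : z.2.1 = y.1) :
    comp (comp x y) z = comp x (comp y z) := by
  apply ext'
  · simp
  · intro i
    rw [phi_comp (by simpa using h'), phi_comp h, phi_comp (by rw [comp_m h', h]), phi_comp h']

lemma id_comp (y : MSArr) : comp (idMS y.2.1) y = y := by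
  apply ext'
  · simp
  · intro i
    rw [phi_comp (by simp)]; simp

lemma comp_id (x : MSArr) : comp x (idMS x.1) = x := by
  apply ext'
  · simp
  · intro i
    rw [phi_comp (by simp)]; simp

lemma interchange {x y x' y' : MSArr} (h : y.2.1 = x.1) (h' : y'.2.1 = x'.1) :
    comp (jux x x') (jux y y') = jux (comp x y) (comp x' y') := by
  apply ext'
  · simp
  · intro i
    rw [phi_comp (by simp [h, h'])]
    simp only [phi_jux, comp_n, comp_m h, phi_comp h, phi_comp h']
    rcases lt_or_ge i y.1 with hi | hi
    · have := phi_lt_m y hi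
      simp only [hi, if_true]
      rw [if_pos (by omega)]
    · simp only [Nat.not_lt.2 hi, if_false]
      rw [if_neg (by omega), h, Nat.add_sub_cancel_left]

/-- The composable pairs with composite `a`. -/
def S (a : MSArr) : Set (MSArr × MSArr) := {p | p.2.2.1 = p.1.1 ∧ comp p.1 p.2 = a}

lemma m_le_n (a : MSArr) : a.2.1 ≤ a.1 := by
  simpa using Fintype.card_le_of_surjective _ a.2.2.2.2

lemma finite_bdd (N : ℕ) : {a : MSArr | a.1 ≤ N}.Finite := by
  have : {a : MSArr | a.1 ≤ N} ⊆ Set.range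
      (fun q : (Σ n : Fin (N + 1), Σ m : Fin (N + 1), MonoSurj n m) =>
        (⟨q.1, q.2.1, q.2.2⟩ : MSArr)) := by
    intro a ha
    have ha' : a.1 ≤ N := ha
    have := m_le_n a
    exact ⟨⟨⟨a.1, by omega⟩, ⟨a.2.1, by omega⟩, a.2.2⟩, rfl⟩
  exact (Set.finite_range _).subset this

lemma S_finite (a : MSArr) : (S a).Finite := by
  refine ((finite_bdd a.1).prod (finite_bdd a.1)).subset ?_
  rintro ⟨x, y⟩ ⟨h, rfl⟩
  have := m_le_n y
  simp only at h
  simp only [Set.mem_prod, Set.mem_ofPred_eq, comp_n]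
  omega

/-- The finset of factorizations. -/
noncomputable def F (a : MSArr) : Finset (MSArr × MSArr) := (S_finite a).toFinset

lemma mem_F {a : MSArr} {p : MSArr × MSArr} :
    p ∈ F a ↔ p.2.2.1 = p.1.1 ∧ comp p.1 p.2 = a := by
  simp [F, S]

/-- The pair associated with a factorization. -/
def pairOf (a : MSArr) (p : FactMS a) : MSArr × MSArr :=
  (⟨p.1.1, a.2.1, p.1.2.1⟩, ⟨a.1, p.1.1, p.1.2.2⟩)

lemma pairOf_inj (a : MSArr) : Function.Injective (pairOf a) := by
  rintro ⟨⟨k, x, y⟩, h⟩ ⟨⟨k', x', y'⟩, h'⟩ he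
  simp only [pairOf, Prod.mk.injEq] at he
  obtain ⟨h1, h2⟩ := he
  have hk : k = k' := congrArg Sigma.fst h1
  subst hk
  simp only [Sigma.mk.injEq, heq_eq_eq, true_and] at h1 h2
  subst h1
  subst h2
  rfl

lemma range_pairOf (a : MSArr) : Set.range (pairOf a) = ↑(F a) := by
  ext ⟨x, y⟩
  simp only [Set.mem_range, Finset.mem_coe, mem_F]
  constructor
  · rintro ⟨⟨⟨k, u, v⟩, h⟩, he⟩
    simp only [pairOf, Prod.mk.injEq] at he
    obtain ⟨rfl, rfl⟩ := he
    refine ⟨rfl, ?_⟩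
    simp only at h
    obtain ⟨n, m, f⟩ := a
    unfold comp
    rw [dif_pos rfl]
    simp only at h ⊢
    congr 2
    exact Subtype.ext h
  · rintro ⟨h, ha⟩
    obtain ⟨n, m, f⟩ := x
    obtain ⟨n', m', g⟩ := y
    simp only at h
    subst h
    have hc : comp ⟨m', m, f⟩ ⟨n', m', g⟩ =
        ⟨n', m, ⟨f.1 ∘ g.1, f.2.1.comp g.2.1, f.2.2.comp g.2.2⟩⟩ := dif_pos rfl
    rw [hc] at ha
    subst ha
    exact ⟨⟨⟨m', f, g⟩, rfl⟩, rfl⟩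

lemma jux_mem {a b : MSArr} {p q : MSArr × MSArr} (hp : p ∈ F a) (hq : q ∈ F b) :
    (jux p.1 q.1, jux p.2 q.2) ∈ F (jux a b) := by
  rw [mem_F] at *
  refine ⟨by simp [hp.1, hq.1], ?_⟩
  rw [interchange hp.1 hq.1, hp.2, hq.2]

lemma F_split {a b : MSArr} {r : MSArr × MSArr} (hr : r ∈ F (jux a b)) :
    ∃ p ∈ F a, ∃ q ∈ F b, (jux p.1 q.1, jux p.2 q.2) = r := by
  obtain ⟨X, Y⟩ := r
  rw [mem_F] at hr
  obtain ⟨h, hc⟩ := hr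
  simp only at h hc
  have hphi : ∀ i, phi X (phi Y i) = phi (jux a b) i := fun i => by rw [← hc, phi_comp h]
  have hcut : ∀ j < a.1, phi X (phi Y j) < phi X (phi Y a.1) := by
    intro j hj
    rw [hphi, hphi, phi_jux, phi_jux, if_pos hj, if_neg (by omega)]
    have := phi_lt_m a hj
    omega
  have hYn : Y.1 = a.1 + b.1 := by rw [← comp_n X Y, hc, jux_n]
  obtain ⟨y, y', hy, rfl⟩ := exists_split Y a.1 (by omega)
    (fun j hj => (phi_mono X).reflect_lt (hcut j hj))
  have hyn : phi (jux y y') a.1 = y.2.1 := by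
    rw [phi_jux, if_neg (by omega)]
    simp [hy, phi_zero]
  rw [jux_m] at h
  obtain ⟨x, x', hx, rfl⟩ := exists_split X y.2.1 (by omega) (by
    intro j hj
    obtain ⟨i, rfl⟩ := phi_surj (jux y y') j
    have hi : i < a.1 := (phi_mono (jux y y')).reflect_lt (by rw [hyn]; exact hj)
    have := hcut i hi
    rwa [hyn] at this)
  rw [jux_n] at h
  have h' : y'.2.1 = x'.1 := by omega
  rw [interchange hx.symm h'] at hc
  obtain ⟨h1, h2⟩ := jux_inj hc (by simpa using hy)
  exact ⟨(x, y), mem_F.2 ⟨hx.symm, h1⟩, (x', y'), mem_F.2 ⟨h', h2⟩, rfl⟩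

/-- The free module. -/
abbrev B (R : Type) [CommRing R] : Type := MSArr →₀ R

variable {R : Type} [CommRing R]

/-- Basis elements. -/
noncomputable abbrev e (a : MSArr) : B R := Finsupp.single a 1

/-- The product. -/
noncomputable def mul : B R →ₗ[R] B R →ₗ[R] B R :=
  Finsupp.linearCombination R fun a => Finsupp.linearCombination R fun b => e (jux a b)

/-- The coproduct. -/
noncomputable def Del : B R →ₗ[R] B R ⊗[R] B R :=
  Finsupp.linearCombination R fun a => ∑ p ∈ F a, e p.1 ⊗ₜ[R] e p.2

open Classical in
/-- The counit. -/
noncomputable def eps : B R →ₗ[R] R :=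
  Finsupp.linearCombination R fun a => if a = idMS a.1 then 1 else 0

lemma mul_e (a b : MSArr) : mul (e a) (e b) = (e (jux a b) : B R) := by
  simp [mul]

lemma Del_e (a : MSArr) : Del (e a : B R) = ∑ p ∈ F a, e p.1 ⊗ₜ[R] e p.2 := by
  simp [Del]

lemma eps_id (n : ℕ) : eps (e (idMS n)) = (1 : R) := by
  simp [eps]

lemma eps_ne {a : MSArr} (h : ∀ n, a ≠ idMS n) : eps (e a) = (0 : R) := by
  simp [eps, h a.1]

lemma ext_e {M : Type*} [AddCommMonoid M] [Module R M] {f g : B R →ₗ[R] M}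
    (h : ∀ a, f (e a) = g (e a)) : f = g :=
  Finsupp.lhom_ext' fun a => LinearMap.ext_ring (h a)

lemma ext_e2 {M : Type*} [AddCommMonoid M] [Module R M] {f g : B R ⊗[R] B R →ₗ[R] M}
    (h : ∀ a b, f (e a ⊗ₜ e b) = g (e a ⊗ₜ e b)) : f = g := by
  apply TensorProduct.ext
  apply ext_e
  intro a
  apply ext_e
  intro b
  exact h a b

lemma mul_assoc' (x y z : B R) : mul (mul x y) z = mul x (mul y z) := by
  induction x using Finsupp.induction_linear with
  | zero => simp
  | add x x' h h' => simp [h, h']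
  | single a r =>
    induction y using Finsupp.induction_linear with
    | zero => simp
    | add y y' h h' => simp [h, h']
    | single b s =>
      induction z using Finsupp.induction_linear with
      | zero => simp
      | add z z' h h' => simp only [map_add, h, h']
      | single c t =>
        rw [← mul_one r, ← mul_one s, ← mul_one t, ← smul_eq_mul, ← smul_eq_mul, ← smul_eq_mul,
          ← Finsupp.smul_single, ← Finsupp.smul_single, ← Finsupp.smul_single]
        simp only [map_smul, LinearMap.smul_apply, mul_e, jux_assoc]

lemma coassoc (R : Type) [CommRing R] : (TensorProduct.assoc R (B R) (B R) (B R)).toLinearMap.comp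
      ((TensorProduct.map Del LinearMap.id).comp Del) =
    (TensorProduct.map LinearMap.id Del).comp Del := by
  apply ext_e
  intro a
  simp only [LinearMap.comp_apply, Del_e, map_sum, TensorProduct.map_tmul, LinearMap.id_apply,
    TensorProduct.sum_tmul, TensorProduct.tmul_sum, LinearEquiv.coe_coe,
    TensorProduct.assoc_tmul]
  rw [Finset.sum_sigma', Finset.sum_sigma']
  refine Finset.sum_bij'
    (fun w _ => ⟨(w.2.1, comp w.2.2 w.1.2), (w.2.2, w.1.2)⟩)
    (fun w _ => ⟨(comp w.1.1 w.2.1, w.2.2), (w.1.1, w.2.1)⟩) ?_ ?_ ?_ ?_ ?_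
  · rintro ⟨⟨x, y⟩, ⟨u, v⟩⟩ h
    simp only [Finset.mem_sigma, mem_F] at h ⊢
    obtain ⟨⟨h1, rfl⟩, h2, rfl⟩ := h
    rw [comp_n] at h1
    refine ⟨⟨by rw [comp_m h1, h2], (comp_assoc h2 h1).symm⟩, h1, trivial⟩
  · rintro ⟨⟨x, y⟩, ⟨u, v⟩⟩ h
    simp only [Finset.mem_sigma, mem_F] at h ⊢
    obtain ⟨⟨h1, rfl⟩, h2, rfl⟩ := h
    rw [comp_m h2] at h1
    refine ⟨⟨by rw [comp_n, h2], comp_assoc h1 h2⟩, h1, trivial⟩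
  · rintro ⟨⟨x, y⟩, ⟨u, v⟩⟩ h
    simp only [Finset.mem_sigma, mem_F] at h ⊢
    rw [h.2.2]
  · rintro ⟨⟨x, y⟩, ⟨u, v⟩⟩ h
    simp only [Finset.mem_sigma, mem_F] at h ⊢
    rw [h.2.2]
  · rintro ⟨⟨x, y⟩, ⟨u, v⟩⟩ h
    rfl

lemma counit_left (R : Type) [CommRing R] : (TensorProduct.lid R (B R)).toLinearMap.comp
    ((TensorProduct.map eps LinearMap.id).comp Del) = LinearMap.id := by
  apply ext_e
  intro a
  simp only [LinearMap.comp_apply, Del_e, map_sum, TensorProduct.map_tmul, LinearMap.id_apply,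
    LinearEquiv.coe_coe, TensorProduct.lid_tmul]
  rw [Finset.sum_eq_single (idMS a.2.1, a)]
  · simp only [eps_id, one_smul]
  · rintro ⟨x, y⟩ h hne
    rw [eps_ne, zero_smul]
    rintro n rfl
    rw [mem_F] at h
    obtain ⟨h1, h2⟩ := h
    simp only [id_n] at h1 h2
    subst h1
    rw [id_comp] at h2
    subst h2
    exact hne rfl
  · intro h
    exact absurd (mem_F.2 ⟨rfl, id_comp a⟩) h

lemma counit_right (R : Type) [CommRing R] : (TensorProduct.rid R (B R)).toLinearMap.comp
    ((TensorProduct.map LinearMap.id eps).comp Del) = LinearMap.id := by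
  apply ext_e
  intro a
  simp only [LinearMap.comp_apply, Del_e, map_sum, TensorProduct.map_tmul, LinearMap.id_apply,
    LinearEquiv.coe_coe, TensorProduct.rid_tmul]
  rw [Finset.sum_eq_single (a, idMS a.1)]
  · simp only [eps_id, one_smul]
  · rintro ⟨x, y⟩ h hne
    rw [eps_ne, zero_smul]
    rintro n rfl
    rw [mem_F] at h
    obtain ⟨h1, h2⟩ := h
    simp only [id_m] at h1 h2
    subst h1
    rw [comp_id] at h2
    subst h2
    exact hne rfl
  · intro h
    exact absurd (mem_F.2 ⟨rfl, comp_id a⟩) h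

lemma Del_mul (R : Type) [CommRing R] : Del.comp (TensorProduct.lift mul) =
    (TensorProduct.map (TensorProduct.lift mul) (TensorProduct.lift mul)).comp
      ((TensorProduct.tensorTensorTensorComm R (B R) (B R) (B R) (B R)).toLinearMap.comp
        (TensorProduct.map Del Del)) := by
  apply ext_e2
  intro a b
  simp only [LinearMap.comp_apply, TensorProduct.lift.tmul, mul_e, Del_e, map_sum,
    TensorProduct.map_tmul, TensorProduct.sum_tmul, TensorProduct.tmul_sum, LinearEquiv.coe_coe,
    TensorProduct.tensorTensorTensorComm_tmul]
  symm
  try rw [Finset.sum_comm]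
  rw [← Finset.sum_product']
  refine Finset.sum_bij (fun w _ => (jux w.1.1 w.2.1, jux w.1.2 w.2.2)) ?_ ?_ ?_ ?_
  · rintro ⟨p, q⟩ h
    rw [Finset.mem_product] at h
    exact jux_mem h.1 h.2
  · rintro ⟨⟨x, y⟩, ⟨x', y'⟩⟩ h ⟨⟨u, v⟩, ⟨u', v'⟩⟩ h' he
    simp only [Finset.mem_product, mem_F] at h h'
    simp only [Prod.mk.injEq] at he
    have hn : y.1 = v.1 := by rw [← comp_n x y, ← comp_n u v, h.1.2, h'.1.2]
    obtain ⟨rfl, rfl⟩ := jux_inj he.2 hn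
    obtain ⟨rfl, rfl⟩ := jux_inj he.1 (by rw [← h.1.1, ← h'.1.1])
    rfl
  · intro r hr
    obtain ⟨p, hp, q, hq, h⟩ := F_split hr
    exact ⟨(p, q), Finset.mem_product.2 ⟨hp, hq⟩, h⟩
  · rintro ⟨p, q⟩ h
    rfl

lemma eps_mul (R : Type) [CommRing R] : eps.comp (TensorProduct.lift mul) =
    (TensorProduct.lid R R).toLinearMap.comp (TensorProduct.map eps eps) := by
  apply ext_e2
  intro a b
  simp only [LinearMap.comp_apply, TensorProduct.lift.tmul, mul_e, TensorProduct.map_tmul,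
    LinearEquiv.coe_coe, TensorProduct.lid_tmul, smul_eq_mul]
  by_cases h : ∃ n, jux a b = idMS n
  · obtain ⟨n, hn⟩ := h
    have hn' : a.1 + b.1 = n := congrArg Sigma.fst hn
    subst hn'
    obtain ⟨h1, h2⟩ := jux_inj (hn.trans (id_jux_id a.1 b.1).symm) rfl
    rw [hn, h1, h2]
    simp only [eps_id, mul_one]
  · push Not at h
    rw [eps_ne h]
    by_cases ha : ∃ n, a = idMS n
    · obtain ⟨n, rfl⟩ := ha
      rw [eps_ne (a := b), mul_zero]
      rintro k rfl
      exact h _ (id_jux_id n k)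
    · push Not at ha
      rw [eps_ne ha, zero_mul]

lemma Del_one : Del (e (idMS 0) : B R) = e (idMS 0) ⊗ₜ[R] e (idMS 0) := by
  rw [Del_e]
  have : F (idMS 0) = {(idMS 0, idMS 0)} := by
    have huniq : ∀ y : MSArr, y.1 = 0 → y = idMS 0 := by
      intro y hy
      have hm := m_le_n y
      refine ext' hy fun i => ?_
      rw [phi_ge y (by omega), phi_id]
      omega
    ext ⟨x, y⟩
    rw [mem_F, Finset.mem_singleton]
    constructor
    · rintro ⟨h1, h2⟩
      simp only at h1 h2
      have hy : y.1 = 0 := by rw [← comp_n x y, h2, id_n]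
      have hm := m_le_n y
      rw [huniq y hy, huniq x (by omega)]
    · intro h
      rw [Prod.mk.injEq] at h
      obtain ⟨rfl, rfl⟩ := h
      exact ⟨rfl, id_comp (idMS 0)⟩
  rw [this, Finset.sum_singleton]

lemma Del_finsum (a : MSArr) : Del (e a : B R) =
    ∑ᶠ p : FactMS a,
      Finsupp.single (⟨p.1.1, a.2.1, p.1.2.1⟩ : MSArr) (1 : R) ⊗ₜ[R]
        Finsupp.single (⟨a.1, p.1.1, p.1.2.2⟩ : MSArr) (1 : R) := by
  rw [Del_e, ← finsum_mem_coe_finset, ← range_pairOf, finsum_mem_range (pairOf_inj a)]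
  rfl

lemma one_mul' (x : B R) : mul (e (idMS 0)) x = x := by
  have : mul (e (idMS 0) : B R) = LinearMap.id := ext_e fun a => by rw [mul_e, id_jux]; rfl
  rw [this]; rfl

lemma mul_one' (x : B R) : mul x (e (idMS 0)) = x := by
  have : mul.flip (e (idMS 0) : B R) = LinearMap.id :=
    ext_e fun a => by rw [LinearMap.flip_apply, mul_e, jux_id]; rfl
  exact (LinearMap.congr_fun this x)

end MSAux

/-- The free `ℤ`-module on all monotone surjections, with product given by
juxtaposition (ordinal sum), unit the empty map, coproduct given by summing
over all factorizations, and counit the indicator of identities, is a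
bialgebra over `ℤ`. -/
theorem stmt_15 :
    ∃ (mul : (MSArr →₀ ℤ) →ₗ[ℤ] (MSArr →₀ ℤ) →ₗ[ℤ] (MSArr →₀ ℤ))
      (Δ : (MSArr →₀ ℤ) →ₗ[ℤ] (MSArr →₀ ℤ) ⊗[ℤ] (MSArr →₀ ℤ))
      (ε : (MSArr →₀ ℤ) →ₗ[ℤ] ℤ),
      -- the product of basis elements is their juxtaposition
      (∀ (a b : MSArr) (hm : Monotone (ordSum a.2.2.1 b.2.2.1))
          (hs : Function.Surjective (ordSum a.2.2.1 b.2.2.1)),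
        mul (Finsupp.single a 1) (Finsupp.single b 1) =
          Finsupp.single
            (⟨a.1 + b.1, a.2.1 + b.2.1, ⟨ordSum a.2.2.1 b.2.2.1, hm, hs⟩⟩ : MSArr) 1) ∧
      -- associativity and unitality of the product
      (∀ x y z, mul (mul x y) z = mul x (mul y z)) ∧
      (∀ x, mul (Finsupp.single (idMS 0) 1) x = x) ∧
      (∀ x, mul x (Finsupp.single (idMS 0) 1) = x) ∧
      -- the coproduct is the sum over all factorizations f = f₀ ∘ f₁
      (∀ a : MSArr,
        Δ (Finsupp.single a 1) =
          ∑ᶠ p : FactMS a,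
            Finsupp.single (⟨p.1.1, a.2.1, p.1.2.1⟩ : MSArr) 1 ⊗ₜ[ℤ]
              Finsupp.single (⟨a.1, p.1.1, p.1.2.2⟩ : MSArr) 1) ∧
      -- the counit is 1 on identities and 0 elsewhere
      (∀ n : ℕ, ε (Finsupp.single (idMS n) 1) = 1) ∧
      (∀ a : MSArr, (∀ n : ℕ, a ≠ idMS n) → ε (Finsupp.single a 1) = 0) ∧
      -- coassociativity
      ((TensorProduct.assoc ℤ _ _ _).toLinearMap.comp
          ((TensorProduct.map Δ LinearMap.id).comp Δ) =
        (TensorProduct.map LinearMap.id Δ).comp Δ) ∧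
      -- counit axioms
      ((TensorProduct.lid ℤ _).toLinearMap.comp
          ((TensorProduct.map ε LinearMap.id).comp Δ) = LinearMap.id) ∧
      ((TensorProduct.rid ℤ _).toLinearMap.comp
          ((TensorProduct.map LinearMap.id ε).comp Δ) = LinearMap.id) ∧
      -- Δ is multiplicative: Δ(x·y) = Δ(x)·Δ(y) with componentwise product
      (Δ.comp (TensorProduct.lift mul) =
        (TensorProduct.map (TensorProduct.lift mul) (TensorProduct.lift mul)).comp
          ((TensorProduct.tensorTensorTensorComm ℤ (MSArr →₀ ℤ) (MSArr →₀ ℤ)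
              (MSArr →₀ ℤ) (MSArr →₀ ℤ)).toLinearMap.comp
            (TensorProduct.map Δ Δ))) ∧
      -- ε is multiplicative
      (ε.comp (TensorProduct.lift mul) =
        (TensorProduct.lid ℤ ℤ).toLinearMap.comp (TensorProduct.map ε ε)) ∧
      -- the unit is group-like
      (Δ (Finsupp.single (idMS 0) 1) =
        Finsupp.single (idMS 0) 1 ⊗ₜ[ℤ] Finsupp.single (idMS 0) 1) ∧
      (ε (Finsupp.single (idMS 0) 1) = 1) := by
  exact ⟨MSAux.mul, MSAux.Del, MSAux.eps, fun a b _ _ => MSAux.mul_e a b, MSAux.mul_assoc',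
    MSAux.one_mul', MSAux.mul_one', MSAux.Del_finsum, MSAux.eps_id, fun _ h => MSAux.eps_ne h,
    MSAux.coassoc ℤ, MSAux.counit_left ℤ, MSAux.counit_right ℤ, MSAux.Del_mul ℤ,
    MSAux.eps_mul ℤ, MSAux.Del_one, MSAux.eps_id 0⟩
end
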